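/- Let f ∈ ℂ[x_0,...,x_n] be homogeneous of degree d with V(f) smooth. Then the Milnor algebra M(f) = S/J_f is an Artinian Gorenstein ring whose one-dimensional socle (in degree T = (n+1)(d-2)) is spanned by the class of the Hessian determinant h(f) = det(∂²f/∂x_i∂x_j). Consequently HP(H_{n+1}(f);t) = HP(M(f);t) - t^T = ((1-t^{d-1})/(1-t))^{n+1} - t^T. -/

import Mathlib

open MvPolynomial

/-- The Jacobian ideal `J_f` of a polynomial, generated by its first order
partial derivatives. -/
noncomputable def jacobianIdeal {m : ℕ} (f : MvPolynomial (Fin m) ℂ) :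
    Ideal (MvPolynomial (Fin m) ℂ) :=
  Ideal.span (Set.range fun i => pderiv i f)

/-- The Hessian matrix of second order partial derivatives of `f`. -/
noncomputable def hessianMatrix {m : ℕ} (f : MvPolynomial (Fin m) ℂ) :
    Matrix (Fin m) (Fin m) (MvPolynomial (Fin m) ℂ) :=
  Matrix.of fun i j => pderiv i (pderiv j f)

/-- The ideal generated by all `k × k` minors of a square matrix. -/
noncomputable def minorsIdeal {m : ℕ} {R : Type*} [CommRing R]
    (M : Matrix (Fin m) (Fin m) R) (k : ℕ) : Ideal R :=
  Ideal.span {x | ∃ r c : Fin k → Fin m, x = (M.submatrix r c).det}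

/-- The degree-`q` graded piece of `S/I`, i.e. the image of the space of
homogeneous polynomials of degree `q` in the quotient. -/
noncomputable def gradedPiece {m : ℕ} (I : Ideal (MvPolynomial (Fin m) ℂ)) (q : ℕ) :
    Submodule ℂ (MvPolynomial (Fin m) ℂ ⧸ I) :=
  (homogeneousSubmodule (Fin m) ℂ q).map (Ideal.Quotient.mkₐ ℂ I).toLinearMap

/-- The Hilbert–Poincaré series `HP(S/I; t) = Σ_q dim (S/I)_q t^q`. -/
noncomputable def hilbertSeries {m : ℕ} (I : Ideal (MvPolynomial (Fin m) ℂ)) :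
    PowerSeries ℤ :=
  PowerSeries.mk fun q => (Module.finrank ℂ (gradedPiece I q) : ℤ)


section Milnor

variable {m : ℕ}

/-- `g` is a nonzerodivisor modulo `I`. -/
def NzMod {R : Type*} [CommRing R] (I : Ideal R) (g : R) : Prop :=
  ∀ z, g * z ∈ I → z ∈ I

/-- Ideals closed under taking homogeneous components. -/
def HomI (I : Ideal (MvPolynomial (Fin m) ℂ)) : Prop :=
  ∀ z ∈ I, ∀ q, homogeneousComponent q z ∈ I

section
attribute [local instance] MvPolynomial.gradedAlgebra

lemma homI_span {T : Set (MvPolynomial (Fin m) ℂ)} (hT : ∀ s ∈ T, ∃ e, s.IsHomogeneous e) :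
    HomI (Ideal.span T) := by
  have : (Ideal.span T).IsHomogeneous (homogeneousSubmodule (Fin m) ℂ) := by
    apply Ideal.homogeneous_span
    intro x hx
    obtain ⟨e, he⟩ := hT x hx
    exact ⟨e, he⟩
  intro z hz q
  exact homogeneousComponent_mem_of_mem this hz q

lemma decompose_coe_eq (z : MvPolynomial (Fin m) ℂ) (q : ℕ) :
    ((DirectSum.decompose (homogeneousSubmodule (Fin m) ℂ) z q : MvPolynomial (Fin m) ℂ)) =
      homogeneousComponent q z :=
  decomposition.decompose'_apply z q

lemma homogComp_mul {g w : MvPolynomial (Fin m) ℂ} {e : ℕ} (hg : g.IsHomogeneous e) (q : ℕ) :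
    homogeneousComponent (e + q) (g * w) = g * homogeneousComponent q w := by
  have h := DirectSum.coe_decompose_mul_add_of_left_mem (homogeneousSubmodule (Fin m) ℂ)
    (i := e) (j := q) (a := g) (b := w) hg
  simpa only [decompose_coe_eq] using h

lemma homogComp_mul_lt {g w : MvPolynomial (Fin m) ℂ} {e : ℕ} (hg : g.IsHomogeneous e) (q : ℕ)
    (hq : q < e) :
    homogeneousComponent q (g * w) = 0 := by
  have h := DirectSum.coe_decompose_mul_of_left_mem_of_not_le (homogeneousSubmodule (Fin m) ℂ)
    (i := e) (n := q) (a := g) (b := w) hg (by omega)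
  simpa only [decompose_coe_eq] using h

end

lemma nzMod_pow {R : Type*} [CommRing R] {I : Ideal R} {g : R} (h : NzMod I g) (N : ℕ) :
    NzMod I (g ^ N) := by
  induction N with
  | zero => intro z hz; simpa using hz
  | succ N ih =>
    intro z hz
    apply ih
    apply h
    rwa [← mul_assoc, ← pow_succ']

lemma nzMod_of_mul {R : Type*} [CommRing R] {I : Ideal R} {a g l : R} (h : NzMod I l)
    (hl : l - a * g ∈ I) : NzMod I g := by
  intro z hz
  apply h
  have h1 := I.mul_mem_left z hl
  have h2 := I.mul_mem_left a hz
  have := I.add_mem h1 h2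
  convert this using 1
  ring

lemma isHom_mem_vars {g : MvPolynomial (Fin m) ℂ} {e N : ℕ} (hg : g.IsHomogeneous e)
    (he : N ≤ e) : g ∈ idealOfVars (Fin m) ℂ ^ N := by
  rw [mem_pow_idealOfVars_iff']
  intro x hx
  apply hg.coeff_eq_zero
  omega

lemma homI_closed {I : Ideal (MvPolynomial (Fin m) ℂ)} (hI : HomI I)
    {z : MvPolynomial (Fin m) ℂ} (h : ∀ n, z ∈ I ⊔ idealOfVars (Fin m) ℂ ^ n) : z ∈ I := by
  rw [← sum_homogeneousComponent z]
  apply Ideal.sum_mem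
  intro q hq
  obtain ⟨i, hi, w, hw, rfl⟩ := Submodule.mem_sup.1 (h (q + 1))
  rw [map_add]
  have : homogeneousComponent q w = 0 := by
    ext x
    rw [coeff_homogeneousComponent]
    split_ifs with h1
    · rw [mem_pow_idealOfVars_iff'] at hw
      rw [hw x (by omega)]; simp
    · simp
  rw [this, add_zero]
  exact hI _ hi q

lemma homI_nakayama {I K : Ideal (MvPolynomial (Fin m) ℂ)} (hI : HomI I)
    {a : MvPolynomial (Fin m) ℂ} (ha : a ∈ idealOfVars (Fin m) ℂ)
    (h : ∀ z ∈ K, ∃ w ∈ K, z - a * w ∈ I) : K ≤ I := by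
  have key : ∀ n, ∀ z ∈ K, z ∈ I ⊔ idealOfVars (Fin m) ℂ ^ n := by
    intro n
    induction n with
    | zero => intro z _; simp
    | succ n ih =>
      intro z hz
      obtain ⟨w, hw, hzw⟩ := h z hz
      obtain ⟨i, hi, v, hv, hiv⟩ := Submodule.mem_sup.1 (ih w hw)
      have h1 : a * v ∈ idealOfVars (Fin m) ℂ ^ (n + 1) := by
        rw [pow_succ']
        exact Ideal.mul_mem_mul ha hv
      have : z = ((z - a * w) + a * i) + a * v := by rw [← hiv]; ring
      rw [this]
      exact Submodule.add_mem_sup (I.add_mem hzw (I.mul_mem_left _ hi)) h1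
  intro z hz
  exact homI_closed hI fun n => key n z hz

/-- Strong regularity: every subset in every order. -/
def SReg {R : Type*} [CommRing R] (y : Fin m → R) : Prop :=
  ∀ (s : Finset (Fin m)) (j : Fin m), j ∉ s → NzMod (Ideal.span (y '' (s : Set (Fin m)))) (y j)

lemma mem_span_insert' {R : Type*} [CommRing R] {T : Set R} {g z : R} :
    z ∈ Ideal.span (insert g T) ↔ ∃ a, z - a * g ∈ Ideal.span T := by
  rw [Ideal.mem_span_insert]
  constructor
  · rintro ⟨a, w, hw, rfl⟩
    exact ⟨a, by simpa using hw⟩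
  · rintro ⟨a, ha⟩
    exact ⟨a, _, ha, by ring⟩

lemma mem_span_range_iff {R : Type*} [CommRing R] (y : Fin m → R) (k : Fin m) (z : R) :
    z ∈ Ideal.span (Set.range y) ↔ ∃ a, z - a * y k ∈ Ideal.span (y '' {k}ᶜ) := by
  rw [← mem_span_insert', ← Set.image_insert_eq, ← Set.image_univ]
  congr!
  ext i
  simp [em]

lemma update_image_of_notMem {R : Type*} (y : Fin m → R) (k : Fin m) (g : R) (s : Set (Fin m))
    (hk : k ∉ s) : Function.update y k g '' s = y '' s := by
  apply Set.image_congr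
  intro i hi
  rw [Function.update_of_ne]
  rintro rfl
  exact hk hi

lemma sreg_exchange {y : Fin m → MvPolynomial (Fin m) ℂ} {e : Fin m → ℕ}
    (hy : ∀ i, (y i).IsHomogeneous (e i)) (he : ∀ i, 1 ≤ e i) (hr : SReg y) (k : Fin m)
    {g : MvPolynomial (Fin m) ℂ} (N : ℕ)
    (hg : y k ^ N ∈ Ideal.span (Set.range (Function.update y k g))) :
    SReg (Function.update y k g) := by
  have hI : ∀ s : Finset (Fin m), HomI (Ideal.span (y '' (s : Set (Fin m)))) := by
    intro s
    apply homI_span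
    rintro _ ⟨i, -, rfl⟩
    exact ⟨_, hy i⟩
  -- step 1 and 2
  have h2 : ∀ n, ∀ s : Finset (Fin m), k ∉ s → ((insert k s)ᶜ).card = n →
      NzMod (Ideal.span (y '' (s : Set (Fin m)))) g := by
    intro n
    induction n with
    | zero =>
      intro s hk hs
      rw [Finset.card_eq_zero, Finset.compl_eq_empty_iff] at hs
      have hs' : (s : Set (Fin m)) = {k}ᶜ := by
        ext i
        have := Finset.mem_univ i
        rw [← hs, Finset.mem_insert] at this
        simp only [Finset.mem_coe, Set.mem_compl_iff, Set.mem_singleton_iff]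
        constructor
        · rintro h rfl; exact hk h
        · intro h; tauto
      rw [mem_span_range_iff _ k] at hg
      obtain ⟨a, ha⟩ := hg
      rw [Function.update_self, update_image_of_notMem _ _ _ _ (by simp), ← hs'] at ha
      exact nzMod_of_mul (nzMod_pow (hr s k hk) N) ha
    | succ n ih =>
      intro s hk hs
      obtain ⟨j, hj⟩ : ((insert k s)ᶜ).Nonempty := by
        rw [← Finset.card_pos]; omega
      have hj' : j ≠ k ∧ j ∉ s := by simpa using hj
      have h3 := ih (insert j s) (by simp [hj'.1.symm, hk]) (by
        rw [Finset.insert_comm, Finset.compl_insert, Finset.card_erase_of_mem hj, hs]; rfl)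
      set K : Ideal (MvPolynomial (Fin m) ℂ) :=
        (Ideal.span (y '' (s : Set (Fin m)))).colon {g} with hK
      have hmK : ∀ z, z ∈ K ↔ g * z ∈ Ideal.span (y '' (s : Set (Fin m))) := by
        intro z
        rw [hK, Submodule.mem_colon_singleton, smul_eq_mul, mul_comm]
      have := homI_nakayama (K := K) (hI s) (a := y j)
        (by simpa using isHom_mem_vars (hy j) (he j)) (by
          intro z hz
          rw [hmK] at hz
          have h4 := h3 z (by
            apply Ideal.span_mono _ hz
            apply Set.image_mono
            simp)
          rw [Finset.coe_insert, Set.image_insert_eq, mem_span_insert'] at h4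
          obtain ⟨w, hw⟩ := h4
          refine ⟨w, ?_, by rwa [mul_comm]⟩
          rw [hmK]
          apply hr s j hj'.2
          have := Ideal.sub_mem _ hz (Ideal.mul_mem_left _ g hw)
          convert this using 1
          ring)
      intro z hz
      exact this ((hmK z).2 hz)
  have h2' : ∀ s : Finset (Fin m), k ∉ s → NzMod (Ideal.span (y '' (s : Set (Fin m)))) g :=
    fun s hk => h2 _ s hk rfl
  intro s j hj
  by_cases hjk : j = k
  · subst hjk
    rw [Function.update_self, update_image_of_notMem _ _ _ _ (by simpa using hj)]
    exact h2' s hj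
  rw [Function.update_of_ne hjk]
  by_cases hks : k ∈ s
  · obtain ⟨t, hkt, rfl⟩ : ∃ t, k ∉ t ∧ insert k t = s :=
      ⟨s.erase k, by simp, Finset.insert_erase hks⟩
    have hjt : j ∉ t := fun h => hj (by simp [h])
    rw [Finset.coe_insert, Set.image_insert_eq, Function.update_self,
      update_image_of_notMem _ _ _ _ (by simpa using hkt)]
    intro z hz
    rw [mem_span_insert'] at hz ⊢
    obtain ⟨w, hw⟩ := hz
    have h5 := h2' (insert j t) (by simp [hkt, Ne.symm hjk]) w (by
      rw [Finset.coe_insert, Set.image_insert_eq, mem_span_insert']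
      refine ⟨z, ?_⟩
      have := Ideal.neg_mem_iff _ |>.2 hw
      convert this using 1
      ring)
    rw [Finset.coe_insert, Set.image_insert_eq, mem_span_insert'] at h5
    obtain ⟨w', hw'⟩ := h5
    refine ⟨w', ?_⟩
    apply hr t j hjt
    have := Ideal.add_mem _ hw (Ideal.mul_mem_left _ g hw')
    convert this using 1
    ring
  · rw [update_image_of_notMem _ _ _ _ (by simpa using hks)]
    exact hr s j hj

/-- The duality property of Wiebe. -/
def Wiebe (y : Fin m → MvPolynomial (Fin m) ℂ) : Prop :=
  ∀ A : Matrix (Fin m) (Fin m) (MvPolynomial (Fin m) ℂ),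
    (∀ i, y i = ∑ j, A i j * X j) →
      A.det ∉ Ideal.span (Set.range y) ∧
      ∀ z, (∀ j, X j * z ∈ Ideal.span (Set.range y)) →
        ∃ c, z - c * A.det ∈ Ideal.span (Set.range y)

lemma cramer_mem {R : Type*} [CommRing R] (I : Ideal R) (B : Matrix (Fin m) (Fin m) R)
    (v : Fin m → R) (h : ∀ i, ∑ j, B i j * v j ∈ I) (j : Fin m) : v j * B.det ∈ I := by
  have h1 : (B.adjugate * B).mulVec v j = v j * B.det := by
    rw [Matrix.adjugate_mul, Matrix.smul_mulVec, Matrix.one_mulVec]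
    simp [mul_comm]
  rw [← h1, ← Matrix.mulVec_mulVec]
  change ∑ i, B.adjugate j i * ∑ l, B i l * v l ∈ I
  apply Ideal.sum_mem
  intro i _
  exact Ideal.mul_mem_left _ _ (h i)

lemma lin_comb_mem {R : Type*} [CommRing R] {I : Ideal R} {u v : R} (p q : R) (hu : u ∈ I)
    (hv : v ∈ I) {z : R} (h : z = p * u + q * v) : z ∈ I := by
  rw [h]
  exact I.add_mem (I.mul_mem_left _ hu) (I.mul_mem_left _ hv)

lemma wiebe_exchange {y : Fin m → MvPolynomial (Fin m) ℂ} (k : Fin m)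
    (hnz : NzMod (Ideal.span (y '' {k}ᶜ)) (y k))
    (ρ : Fin m → MvPolynomial (Fin m) ℂ) (hρ : y k = ∑ j, ρ j * X j)
    {g : MvPolynomial (Fin m) ℂ} (N : ℕ)
    (hg : y k ^ (N + 1) ∈ Ideal.span (Set.range (Function.update y k g)))
    (hW : Wiebe y) : Wiebe (Function.update y k g) := by
  intro A hA
  set I := Ideal.span (y '' {k}ᶜ) with hI
  have hmem : ∀ z, z ∈ Ideal.span (Set.range (Function.update y k g)) ↔ ∃ a, z - a * g ∈ I := by
    intro z
    rw [mem_span_range_iff _ k, Function.update_self, update_image_of_notMem _ _ _ _ (by simp)]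
  have hmem' : ∀ z, z ∈ Ideal.span (Set.range y) ↔ ∃ a, z - a * y k ∈ I :=
    fun z => mem_span_range_iff _ k z
  set l := y k with hl
  obtain ⟨a, ha⟩ := (hmem _).1 hg
  have hnza : NzMod I a := nzMod_of_mul (a := g) (nzMod_pow hnz (N + 1)) (by rwa [mul_comm])
  have hAk : g = ∑ j, A k j * X j := by simpa using hA k
  have hAi : ∀ i, i ≠ k → y i = ∑ j, A i j * X j := by
    intro i hi
    simpa [hi] using hA i
  have hyi : ∀ i, i ≠ k → y i ∈ I := fun i hi => Ideal.subset_span ⟨i, by simpa using hi, rfl⟩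
  set A' := A.updateRow k ρ with hA'
  obtain ⟨hW1, hW2⟩ := hW A' (by
    intro i
    by_cases hi : i = k
    · subst hi; simpa [hA'] using hρ
    · simp [hA', hi, hAi])
  have hD : l ^ N * A'.det - a * A.det ∈ I := by
    set B := A.updateRow k (l ^ N • ρ + (-a) • A k) with hB
    have hdet : B.det = l ^ N * A'.det - a * A.det := by
      rw [hB, Matrix.det_updateRow_add, Matrix.det_updateRow_smul, Matrix.det_updateRow_smul,
        Matrix.updateRow_eq_self]
      ring
    rw [← hdet]
    have hX := cramer_mem I B X (by
      intro i
      by_cases hi : i = k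
      · subst hi
        have : ∑ j, B i j * X j = l ^ (N + 1) - a * g := by
          rw [hAk, pow_succ]
          nth_rewrite 2 [hρ]
          rw [Finset.mul_sum, Finset.mul_sum, ← Finset.sum_sub_distrib]
          apply Finset.sum_congr rfl
          intro j _
          simp [hB]
          ring
        rw [this]
        exact ha
      · have : ∑ j, B i j * X j = y i := by
          rw [hAi i hi]; simp [hB, hi]
        rw [this]; exact hyi i hi)
    apply hnz
    rw [hρ, Finset.sum_mul]
    apply Ideal.sum_mem
    intro j _
    rw [mul_assoc]
    exact Ideal.mul_mem_left _ _ (hX j)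
  have hnzN := nzMod_pow hnz N
  constructor
  · intro h
    obtain ⟨c, hc⟩ := (hmem _).1 h
    apply hW1
    rw [hmem']
    refine ⟨c, hnzN _ ?_⟩
    have h1 := lin_comb_mem (z := l ^ N * A'.det - a * c * g) 1 a hD hc (by ring)
    exact lin_comb_mem 1 (-c) h1 ha (by ring)
  · intro z hz
    choose c hc using fun j => (hmem _).1 (hz j)
    have h1 : ∀ j, X j * (a * z) - c j * l ^ (N + 1) ∈ I := fun j =>
      lin_comb_mem a (-c j) (hc j) ha (by ring)
    have h2 : a * z - (∑ j, ρ j * c j) * l ^ N ∈ I := by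
      apply hnz
      have : l * (a * z - (∑ j, ρ j * c j) * l ^ N) =
          ∑ j, ρ j * (X j * (a * z) - c j * l ^ (N + 1)) := by
        rw [mul_sub, pow_succ]
        nth_rewrite 1 [hρ]
        rw [show l * ((∑ j, ρ j * c j) * l ^ N) = (∑ j, ρ j * c j) * (l ^ N * l) by ring,
          Finset.sum_mul, Finset.sum_mul, ← Finset.sum_sub_distrib]
        apply Finset.sum_congr rfl
        intro j _
        ring
      rw [this]
      exact Ideal.sum_mem _ fun j _ => Ideal.mul_mem_left _ _ (h1 j)
    set s := ∑ j, ρ j * c j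
    obtain ⟨t, ht⟩ := hW2 s (by
      intro j
      rw [hmem']
      refine ⟨c j, hnzN _ ?_⟩
      exact lin_comb_mem 1 (- X j) (h1 j) h2 (by ring))
    obtain ⟨w, hw⟩ := (hmem' _).1 ht
    refine ⟨t, ?_⟩
    rw [hmem]
    refine ⟨w, hnza _ ?_⟩
    have h3 := lin_comb_mem (z := a * z - t * (l ^ N * A'.det) - w * l ^ (N + 1)) 1 (l ^ N) h2 hw
      (by ring)
    have h4 := lin_comb_mem (z := a * z - t * (a * A.det) - w * l ^ (N + 1)) 1 t h3 hD (by ring)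
    exact lin_comb_mem 1 w h4 ha (by ring)

lemma finrank_map_of_inj {V W : Type*} [AddCommGroup V] [Module ℂ V] [AddCommGroup W] [Module ℂ W]
    {f : V →ₗ[ℂ] W} (hf : Function.Injective f) (p : Submodule ℂ V) :
    Module.finrank ℂ (p.map f) = Module.finrank ℂ p :=
  (Submodule.equivMapOfInjective f hf p).finrank_eq.symm

instance gradedPiece_finite (I : Ideal (MvPolynomial (Fin m) ℂ)) (q : ℕ) :
    Module.Finite ℂ (gradedPiece I q) := by
  have : Module.Finite ℂ (homogeneousSubmodule (Fin m) ℂ q) :=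
    Module.Finite.iff_fg.2 (homogeneousSubmodule_fg _ _ q)
  unfold gradedPiece
  infer_instance

lemma mem_gradedPiece {I : Ideal (MvPolynomial (Fin m) ℂ)} {q : ℕ}
    {v : MvPolynomial (Fin m) ℂ ⧸ I} :
    v ∈ gradedPiece I q ↔ ∃ p : MvPolynomial (Fin m) ℂ, p.IsHomogeneous q ∧
      Ideal.Quotient.mk I p = v := by
  rfl

lemma finrank_gradedPiece_le {I J : Ideal (MvPolynomial (Fin m) ℂ)} (h : I ≤ J) (q : ℕ) :
    Module.finrank ℂ (gradedPiece J q) +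
      Module.finrank ℂ (LinearMap.ker (Ideal.Quotient.factorₐ ℂ h).toLinearMap ⊓
        gradedPiece I q : Submodule ℂ _) = Module.finrank ℂ (gradedPiece I q) := by
  have h1 : gradedPiece J q = (gradedPiece I q).map (Ideal.Quotient.factorₐ ℂ h).toLinearMap := by
    unfold gradedPiece
    rw [← Submodule.map_comp]
    rfl
  have h2 := LinearMap.finrank_range_add_finrank_ker
    ((Ideal.Quotient.factorₐ ℂ h).toLinearMap.domRestrict (gradedPiece I q))
  rw [LinearMap.range_domRestrict, ← h1, LinearMap.ker_domRestrict] at h2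
  rw [← h2]
  congr 1
  rw [inf_comm, ← Submodule.map_comap_subtype]
  exact (finrank_map_of_inj (Submodule.subtype_injective _) _)

lemma hilbert_step {I J : Ideal (MvPolynomial (Fin m) ℂ)} (hI : HomI I)
    {g : MvPolynomial (Fin m) ℂ} {e : ℕ} (hg : g.IsHomogeneous e) (hnz : NzMod I g)
    (hJ : ∀ z, z ∈ J ↔ ∃ a, z - a * g ∈ I) :
    hilbertSeries J = (1 - PowerSeries.X ^ e) * hilbertSeries I := by
  have hIJ : I ≤ J := fun z hz => (hJ z).2 ⟨0, by simpa using hz⟩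
  ext q
  rw [sub_mul, one_mul, map_sub, PowerSeries.coeff_X_pow_mul']
  simp only [hilbertSeries, PowerSeries.coeff_mk]
  have h1 := finrank_gradedPiece_le hIJ q
  have h2 : Module.finrank ℂ (LinearMap.ker (Ideal.Quotient.factorₐ ℂ hIJ).toLinearMap ⊓
        gradedPiece I q : Submodule ℂ _) =
      if e ≤ q then Module.finrank ℂ (gradedPiece I (q - e)) else 0 := by
    have hmem : ∀ p : MvPolynomial (Fin m) ℂ, p.IsHomogeneous q → p ∈ J →
        ∃ a, p - homogeneousComponent q (a * g) ∈ I := by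
      intro p hp hpJ
      obtain ⟨a, ha⟩ := (hJ p).1 hpJ
      have := hI _ ha q
      rw [map_sub, homogeneousComponent_eq_self hp] at this
      exact ⟨a, this⟩
    split_ifs with hq
    · have h3 : LinearMap.ker (Ideal.Quotient.factorₐ ℂ hIJ).toLinearMap ⊓ gradedPiece I q =
          (gradedPiece I (q - e)).map (LinearMap.mulLeft ℂ (Ideal.Quotient.mk I g)) := by
        ext v
        rw [Submodule.mem_inf, Submodule.mem_map, LinearMap.mem_ker]
        constructor
        · rintro ⟨hv, hv2⟩
          obtain ⟨p, hp, rfl⟩ := mem_gradedPiece.1 hv2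
          have hpJ : p ∈ J := Ideal.Quotient.eq_zero_iff_mem.1 hv
          obtain ⟨a, ha⟩ := hmem p hp hpJ
          obtain ⟨r, rfl⟩ := Nat.exists_eq_add_of_le hq
          rw [mul_comm a, homogComp_mul hg] at ha
          refine ⟨Ideal.Quotient.mk I (homogeneousComponent r a), ?_, ?_⟩
          · rw [mem_gradedPiece]
            refine ⟨_, ?_, rfl⟩
            rw [Nat.add_sub_cancel_left]
            exact homogeneousComponent_isHomogeneous _ _
          · rw [LinearMap.mulLeft_apply, ← map_mul]
            exact (Ideal.Quotient.eq.2 ha).symm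
        · rintro ⟨w, hw, rfl⟩
          obtain ⟨p, hp, rfl⟩ := mem_gradedPiece.1 hw
          rw [LinearMap.mulLeft_apply, ← map_mul]
          constructor
          · apply Ideal.Quotient.eq_zero_iff_mem.2
            rw [hJ]
            exact ⟨p, by rw [mul_comm, sub_self]; exact I.zero_mem⟩
          · rw [mem_gradedPiece]
            refine ⟨_, ?_, rfl⟩
            have := hg.mul hp
            rwa [Nat.add_sub_cancel' hq] at this
      rw [h3]
      apply finrank_map_of_inj
      rw [← LinearMap.ker_eq_bot, LinearMap.ker_eq_bot']
      intro v hv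
      obtain ⟨p, rfl⟩ := Ideal.Quotient.mk_surjective v
      rw [LinearMap.mulLeft_apply, ← map_mul, Ideal.Quotient.eq_zero_iff_mem] at hv
      rw [Ideal.Quotient.eq_zero_iff_mem]
      exact hnz _ hv
    · rw [Submodule.finrank_eq_zero, eq_bot_iff]
      rintro v ⟨hv, hv2⟩
      obtain ⟨p, hp, rfl⟩ := mem_gradedPiece.1 hv2
      have hpJ : p ∈ J := Ideal.Quotient.eq_zero_iff_mem.1 hv
      obtain ⟨a, ha⟩ := hmem p hp hpJ
      rw [mul_comm a, homogComp_mul_lt hg _ (by omega), sub_zero] at ha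
      exact Ideal.Quotient.eq_zero_iff_mem.2 ha
  rw [h2] at h1
  split_ifs at h1 ⊢ <;> omega

/-- Adding a homogeneous socle element to the ideal. -/
lemma hilbert_socle {I J : Ideal (MvPolynomial (Fin m) ℂ)} (hI : HomI I)
    {g : MvPolynomial (Fin m) ℂ} {e : ℕ} (hg : g.IsHomogeneous e) (hgI : g ∉ I)
    (hJ : ∀ z, z ∈ J ↔ ∃ c : ℂ, z - C c * g ∈ I) :
    hilbertSeries J = hilbertSeries I - PowerSeries.X ^ e := by
  have hIJ : I ≤ J := fun z hz => (hJ z).2 ⟨0, by simpa using hz⟩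
  ext q
  rw [map_sub, PowerSeries.coeff_X_pow]
  simp only [hilbertSeries, PowerSeries.coeff_mk]
  have h1 := finrank_gradedPiece_le hIJ q
  have h2 : Module.finrank ℂ (LinearMap.ker (Ideal.Quotient.factorₐ ℂ hIJ).toLinearMap ⊓
        gradedPiece I q : Submodule ℂ _) = if q = e then 1 else 0 := by
    have hmem : ∀ p : MvPolynomial (Fin m) ℂ, p.IsHomogeneous q → p ∈ J →
        ∃ c : ℂ, p - C c * homogeneousComponent q g ∈ I := by
      intro p hp hpJ
      obtain ⟨a, ha⟩ := (hJ p).1 hpJ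
      have := hI _ ha q
      rw [map_sub, homogeneousComponent_eq_self hp, homogeneousComponent_C_mul] at this
      exact ⟨a, this⟩
    split_ifs with hq
    · subst hq
      have h3 : LinearMap.ker (Ideal.Quotient.factorₐ ℂ hIJ).toLinearMap ⊓ gradedPiece I q =
          Submodule.span ℂ {Ideal.Quotient.mk I g} := by
        apply le_antisymm
        · rintro v ⟨hv, hv2⟩
          obtain ⟨p, hp, rfl⟩ := mem_gradedPiece.1 hv2
          have hpJ : p ∈ J := Ideal.Quotient.eq_zero_iff_mem.1 hv
          obtain ⟨c, hc⟩ := hmem p hp hpJ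
          rw [homogeneousComponent_eq_self hg] at hc
          rw [Submodule.mem_span_singleton]
          refine ⟨c, ?_⟩
          rw [Ideal.Quotient.eq.2 hc, ← smul_eq_C_mul]
          rfl
        · rw [Submodule.span_singleton_le_iff_mem]
          constructor
          · apply Ideal.Quotient.eq_zero_iff_mem.2
            exact (hJ _).2 ⟨1, by simp⟩
          · exact mem_gradedPiece.2 ⟨g, hg, rfl⟩
      rw [h3]
      apply finrank_span_singleton
      rwa [Ne, Ideal.Quotient.eq_zero_iff_mem]
    · rw [Submodule.finrank_eq_zero, eq_bot_iff]
      rintro v ⟨hv, hv2⟩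
      obtain ⟨p, hp, rfl⟩ := mem_gradedPiece.1 hv2
      have hpJ : p ∈ J := Ideal.Quotient.eq_zero_iff_mem.1 hv
      obtain ⟨a, ha⟩ := hmem p hp hpJ
      rw [homogeneousComponent_of_mem hg, if_neg (by tauto), mul_zero, sub_zero] at ha
      exact Ideal.Quotient.eq_zero_iff_mem.2 ha
  rw [h2] at h1
  split_ifs at h1 ⊢ <;> omega

lemma prime_relation {p : Ideal (MvPolynomial (Fin m) ℂ)} [hp : p.IsPrime]
    {u g : MvPolynomial (Fin m) ℂ} (hu : u ∉ p) (s : ℕ) (c : Fin (s + 1) → ℂ) (hc : ∃ i, c i ≠ 0)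
    (h : ∑ i, C (c i) * (u ^ (i : ℕ) * g ^ (s - i)) ∈ p) : ∃ r w, g ^ r - u * w ∈ p := by
  induction s with
  | zero =>
    obtain ⟨i, hi⟩ := hc
    obtain rfl : i = 0 := by ext; simp
    simp only [Fin.sum_univ_succ, Finset.univ_eq_empty, Finset.sum_empty] at h
    refine ⟨0, 0, ?_⟩
    have := p.mul_mem_left (C (c 0)⁻¹) h
    have h2 : (C (c 0)⁻¹ * C (c 0) : MvPolynomial (Fin m) ℂ) = 1 := by
      rw [← C_mul, inv_mul_cancel₀ hi, C_1]
    simp only [Fin.val_zero, pow_zero, mul_one, add_zero, Nat.sub_zero] at this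
    rw [h2] at this
    simpa using this
  | succ s ih =>
    rw [Fin.sum_univ_succ] at h
    have h1 : ∑ i : Fin (s + 1), C (c i.succ) * (u ^ (i.succ : ℕ) * g ^ (s + 1 - i.succ)) =
        u * ∑ i : Fin (s + 1), C (c i.succ) * (u ^ (i : ℕ) * g ^ (s - i)) := by
      rw [Finset.mul_sum]
      apply Finset.sum_congr rfl
      intro i _
      rw [Fin.val_succ, Nat.add_sub_add_right, pow_succ]
      ring
    rw [h1] at h
    by_cases h0 : c 0 = 0
    · rw [h0, map_zero, zero_mul, zero_add] at h
      apply ih (fun i => c i.succ) _ ((hp.mem_or_mem h).resolve_left hu)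
      obtain ⟨i, hi⟩ := hc
      refine Fin.cases (fun h => absurd h0 h) (fun i hi => ⟨i, hi⟩) i hi
    · set w := ∑ i : Fin (s + 1), C (c i.succ) * (u ^ (i : ℕ) * g ^ (s - i))
      refine ⟨s + 1, - C (c 0)⁻¹ * w, ?_⟩
      have := p.mul_mem_left (C (c 0)⁻¹) h
      have h2 : (C (c 0)⁻¹ * C (c 0) : MvPolynomial (Fin m) ℂ) = 1 := by
        rw [← C_mul, inv_mul_cancel₀ h0, C_1]
      convert this using 1
      simp only [Fin.val_zero, pow_zero, one_mul, Nat.sub_zero]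
      linear_combination (-g ^ (s + 1)) * h2

/-- Linear forms. -/
noncomputable def linF : (Fin m → ℂ) →ₗ[ℂ] MvPolynomial (Fin m) ℂ :=
  Fintype.linearCombination ℂ (X : Fin m → MvPolynomial (Fin m) ℂ)

lemma linF_apply (c : Fin m → ℂ) : linF c = ∑ j, C (c j) * X j := by
  simp [linF, Fintype.linearCombination_apply, smul_eq_C_mul]

lemma linF_hom (c : Fin m → ℂ) : (linF c).IsHomogeneous 1 := by
  rw [linF_apply]
  apply IsHomogeneous.sum
  intro i _
  exact isHomogeneous_C_mul_X _ _

lemma exists_relation {I : Ideal (MvPolynomial (Fin m) ℂ)} (hI : HomI I)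
    {g : MvPolynomial (Fin m) ℂ} {e : ℕ} (hg : g.IsHomogeneous e) (he : 1 ≤ e) {N : ℕ}
    (hN : ∀ z ∈ idealOfVars (Fin m) ℂ ^ N, ∃ a, z - a * g ∈ I) :
    ∃ s : ℕ, ∀ l : MvPolynomial (Fin m) ℂ, l.IsHomogeneous 1 →
      ∃ c : Fin (s + 1) → ℂ, (∃ i, c i ≠ 0) ∧
        ∑ i, C (c i) * ((l ^ e) ^ (i : ℕ) * g ^ (s - i)) ∈ I := by
  have hstep : ∀ r, N ≤ e + r →
      Module.finrank ℂ (gradedPiece I (e + r)) ≤ Module.finrank ℂ (gradedPiece I r) := by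
    intro r hr
    have h1 : gradedPiece I (e + r) ≤
        (gradedPiece I r).map (LinearMap.mulLeft ℂ (Ideal.Quotient.mk I g)) := by
      intro v hv
      obtain ⟨p, hp, rfl⟩ := mem_gradedPiece.1 hv
      obtain ⟨a, ha⟩ := hN p (isHom_mem_vars hp hr)
      have := hI _ ha (e + r)
      rw [map_sub, homogeneousComponent_eq_self hp, mul_comm, homogComp_mul hg] at this
      refine ⟨Ideal.Quotient.mk I (homogeneousComponent r a), ?_, ?_⟩
      · exact mem_gradedPiece.2 ⟨_, homogeneousComponent_isHomogeneous _ _, rfl⟩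
      · rw [LinearMap.mulLeft_apply, ← map_mul]
        exact (Ideal.Quotient.eq.2 this).symm
    exact (Submodule.finrank_mono h1).trans (Submodule.finrank_map_le _ _)
  have hbd : ∀ t, Module.finrank ℂ (gradedPiece I (e * (N + t))) ≤
      Module.finrank ℂ (gradedPiece I (e * N)) := by
    intro t
    induction t with
    | zero => rfl
    | succ t ih =>
      refine le_trans ?_ ih
      have : e * (N + (t + 1)) = e + e * (N + t) := by ring
      rw [this]
      apply hstep
      nlinarith
  set B := Module.finrank ℂ (gradedPiece I (e * N))
  refine ⟨N + B, fun l hl => ?_⟩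
  let v : Fin (N + B + 1) → gradedPiece I (e * (N + B)) := fun i =>
    ⟨Ideal.Quotient.mk I ((l ^ e) ^ (i : ℕ) * g ^ (N + B - i)), mem_gradedPiece.2 ⟨_, by
      have h1 := ((hl.pow e).pow (i : ℕ)).mul (hg.pow (N + B - i))
      have h2 : 1 * e * (i : ℕ) + e * (N + B - i) = e * (N + B) := by
        rw [one_mul, ← mul_add, Nat.add_sub_cancel' (by omega)]
      rwa [h2] at h1, rfl⟩⟩
  have hv : ¬ LinearIndependent ℂ v := by
    intro h
    have := h.fintype_card_le_finrank
    rw [Fintype.card_fin] at this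
    have := hbd B
    omega
  rw [Fintype.not_linearIndependent_iff] at hv
  obtain ⟨c, hc, hi⟩ := hv
  refine ⟨c, hi, ?_⟩
  rw [← Ideal.Quotient.eq_zero_iff_mem, map_sum]
  have := congrArg Subtype.val hc
  rw [AddSubmonoidClass.coe_finsetSum] at this
  convert this using 1
  · apply Finset.sum_congr rfl
    intro i _
    rw [← smul_eq_C_mul]
    rfl
  · rfl

lemma exists_linear {y : Fin m → MvPolynomial (Fin m) ℂ} {e : Fin m → ℕ}
    (hy : ∀ i, (y i).IsHomogeneous (e i)) (he : ∀ i, 1 ≤ e i)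
    (hrad : idealOfVars (Fin m) ℂ ≤ (Ideal.span (Set.range y)).radical) (k : Fin m) :
    ∃ c : Fin m → ℂ,
      idealOfVars (Fin m) ℂ ≤ (Ideal.span (Set.range (Function.update y k (linF c)))).radical := by
  set I := Ideal.span (y '' {k}ᶜ) with hIdef
  have hI : HomI I := by
    apply homI_span
    rintro _ ⟨i, -, rfl⟩
    exact ⟨_, hy i⟩
  obtain ⟨N, hN⟩ := Ideal.exists_pow_le_of_le_radical_of_fg hrad (idealOfVars_fg _ _)
  obtain ⟨s, hs⟩ := exists_relation hI (hy k) (he k) (N := N)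
    (fun z hz => (mem_span_range_iff y k z).1 (hN hz))
  have hfin : I.minimalPrimes.Finite := Ideal.finite_minimalPrimes_of_isNoetherianRing _ I
  -- choose the linear form
  obtain ⟨c, hc⟩ : ∃ c : Fin m → ℂ, ∀ p ∈ I.minimalPrimes, ¬ idealOfVars (Fin m) ℂ ≤ p →
      linF c ∉ p := by
    classical
    let F : Ideal (MvPolynomial (Fin m) ℂ) → Subspace ℂ (Fin m → ℂ) := fun p =>
      (p.restrictScalars ℂ).comap linF
    let T : Finset (Subspace ℂ (Fin m → ℂ)) :=
      (hfin.toFinset.filter fun p => ¬ idealOfVars (Fin m) ℂ ≤ p).image F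
    have hT : ⊤ ∉ T := by
      intro h
      obtain ⟨p, hp, hpF⟩ := Finset.mem_image.1 h
      apply (Finset.mem_filter.1 hp).2
      rw [idealOfVars, Ideal.span_le]
      rintro _ ⟨j, rfl⟩
      have : (Pi.single j 1 : Fin m → ℂ) ∈ F p := by rw [hpF]; trivial
      have h2 : linF (Pi.single j 1 : Fin m → ℂ) ∈ p := this
      simpa [linF] using h2
    have := Subspace.biUnion_ne_univ_of_top_notMem hT
    rw [Set.ne_univ_iff_exists_notMem] at this
    obtain ⟨c, hc⟩ := this
    refine ⟨c, fun p hp hpn hcp => hc ?_⟩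
    simp only [Set.mem_iUnion]
    exact ⟨F p, Finset.mem_image.2 ⟨p, by simp [hp, hpn], rfl⟩, hcp⟩
  refine ⟨c, ?_⟩
  rw [Ideal.radical_eq_sInf]
  apply le_sInf
  rintro P ⟨hP, hPp⟩
  have hIP : I ≤ P := by
    refine le_trans ?_ hP
    rw [hIdef, ← update_image_of_notMem y k (linF c) {k}ᶜ (by simp)]
    exact Ideal.span_mono (Set.image_subset_range _ _)
  have hlP : linF c ∈ P := hP (Ideal.subset_span ⟨k, by simp⟩)
  obtain ⟨p, hp, hpP⟩ := Ideal.exists_minimalPrimes_le hIP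
  by_cases hvp : idealOfVars (Fin m) ℂ ≤ p
  · exact hvp.trans hpP
  have hl := hc p hp hvp
  have hpp : p.IsPrime := hp.1.1
  obtain ⟨d, hd, hd2⟩ := hs (linF c) (linF_hom c)
  obtain ⟨r, w, hrw⟩ := prime_relation (p := p) (u := linF c ^ e k) (g := y k)
    (fun h => hl (hpp.mem_of_pow_mem _ h)) s d hd (hp.1.2 hd2)
  have hgP : y k ∈ P := by
    apply hPp.mem_of_pow_mem r
    have h1 := hpP hrw
    have h2 : linF c ^ e k * w ∈ P :=
      P.mul_mem_right _ (P.pow_mem_of_mem hlP _ (he k))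
    simpa using P.add_mem h1 h2
  have hyP : Ideal.span (Set.range y) ≤ P := by
    intro z hz
    obtain ⟨a, ha⟩ := (mem_span_range_iff y k z).1 hz
    simpa using P.add_mem (hIP ha) (P.mul_mem_left a hgP)
  exact hrad.trans (hPp.radical_le_iff.2 hyP)

lemma mem_vars_iff (p : MvPolynomial (Fin m) ℂ) :
    p ∈ idealOfVars (Fin m) ℂ ↔ constantCoeff p = 0 := by
  have := mem_pow_idealOfVars_iff' 1 p
  rw [pow_one] at this
  rw [this]
  constructor
  · intro h
    exact h 0 (by simp)
  · intro h x hx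
    have : x = 0 := by
      rw [← Finsupp.degree_eq_zero_iff]
      omega
    subst this
    exact h

lemma hilbert_top : hilbertSeries (⊤ : Ideal (MvPolynomial (Fin m) ℂ)) = 0 := by
  ext q
  have : Subsingleton (MvPolynomial (Fin m) ℂ ⧸ (⊤ : Ideal (MvPolynomial (Fin m) ℂ))) :=
    Ideal.Quotient.subsingleton_iff.2 rfl
  simp only [hilbertSeries, PowerSeries.coeff_mk, map_zero, Nat.cast_eq_zero]
  have h0 : gradedPiece (⊤ : Ideal (MvPolynomial (Fin m) ℂ)) q = ⊥ :=
    (Submodule.eq_bot_iff _).2 fun x _ => Subsingleton.elim _ _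
  rw [h0, finrank_bot]

lemma hilbert_vars : hilbertSeries (idealOfVars (Fin m) ℂ) = 1 := by
  have := hilbert_socle (I := idealOfVars (Fin m) ℂ) (J := ⊤) (g := 1) (e := 0)
    (by
      apply homI_span
      rintro _ ⟨i, rfl⟩
      exact ⟨1, isHomogeneous_X _ _⟩) (isHomogeneous_one _ _)
    (by rw [mem_vars_iff]; simp) (by
      intro z
      refine ⟨fun _ => ⟨constantCoeff z, ?_⟩, fun _ => trivial⟩
      rw [mem_vars_iff]
      simp)
  rw [hilbert_top, pow_zero] at this
  exact (sub_eq_zero.1 this.symm)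

lemma sreg_X : SReg (X : Fin m → MvPolynomial (Fin m) ℂ) := by
  intro s j hj z hz
  rw [mem_ideal_span_X_image] at hz ⊢
  intro d hd
  obtain ⟨i, hi, h⟩ := hz (Finsupp.single j 1 + d) (by
    rw [mem_support_iff, add_comm, mul_comm, coeff_mul_X]
    exact mem_support_iff.1 hd)
  refine ⟨i, hi, ?_⟩
  have : j ≠ i := by rintro rfl; exact hj hi
  simpa [Finsupp.single_apply, this] using h

lemma base_case (M : Matrix (Fin m) (Fin m) ℂ)
    (hrad : idealOfVars (Fin m) ℂ ≤ (Ideal.span (Set.range fun i => linF (M i))).radical) :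
    SReg (fun i => linF (M i)) ∧ Wiebe (fun i => linF (M i)) ∧
      Ideal.span (Set.range fun i => linF (M i)) = idealOfVars (Fin m) ℂ := by
  have hdet : M.det ≠ 0 := by
    intro h
    obtain ⟨v, hv, hMv⟩ := Matrix.exists_mulVec_eq_zero_iff.2 h
    apply hv
    funext j
    have h1 : Ideal.span (Set.range fun i => linF (M i)) ≤ RingHom.ker (eval v) := by
      rw [Ideal.span_le]
      rintro _ ⟨i, rfl⟩
      have := congrFun hMv i
      simp only [SetLike.mem_coe, RingHom.mem_ker, linF_apply, map_sum, map_mul, eval_C, eval_X]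
      exact this
    have h2 := (RingHom.ker_isPrime (eval v)).radical_le_iff.2 h1
    have h3 := h2 (hrad (Ideal.subset_span ⟨j, rfl⟩))
    simpa using h3
  have hu : IsUnit M.det := isUnit_iff_ne_zero.2 hdet
  have hcomb : ∀ (P Q : Matrix (Fin m) (Fin m) ℂ) i,
      ∑ j, C (P i j) * linF (Q j) = linF ((P * Q) i) := by
    intro P Q i
    have : (P * Q) i = ∑ j, P i j • Q j := by
      funext l
      simp [Matrix.mul_apply]
    rw [this, map_sum]
    apply Finset.sum_congr rfl
    intro j _
    rw [map_smul, smul_eq_C_mul]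
  have hone : ∀ i, linF ((1 : Matrix (Fin m) (Fin m) ℂ) i) = X i := by
    intro i
    rw [linF_apply]
    simp [Matrix.one_apply]
  have hspan : Ideal.span (Set.range fun i => linF (M i)) = idealOfVars (Fin m) ℂ := by
    apply le_antisymm
    · rw [Ideal.span_le]
      rintro _ ⟨i, rfl⟩
      simpa using isHom_mem_vars (linF_hom (M i)) le_rfl
    · rw [idealOfVars, Ideal.span_le]
      rintro _ ⟨i, rfl⟩
      rw [← hone, ← Matrix.nonsing_inv_mul _ hu, ← hcomb]
      apply Ideal.sum_mem
      intro j _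
      exact Ideal.mul_mem_left _ _ (Ideal.subset_span ⟨j, rfl⟩)
  refine ⟨?_, ?_, hspan⟩
  · let φ : MvPolynomial (Fin m) ℂ →ₐ[ℂ] MvPolynomial (Fin m) ℂ := aeval fun i => linF (M i)
    let ψ : MvPolynomial (Fin m) ℂ →ₐ[ℂ] MvPolynomial (Fin m) ℂ := aeval fun i => linF (M⁻¹ i)
    have hφX : ∀ i, φ (X i) = linF (M i) := fun i => aeval_X _ _
    have hψX : ∀ i, ψ (X i) = linF (M⁻¹ i) := fun i => aeval_X _ _
    have hψy : ∀ i, ψ (linF (M i)) = X i := by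
      intro i
      rw [linF_apply, map_sum, ← hone, ← Matrix.mul_nonsing_inv _ hu, ← hcomb]
      apply Finset.sum_congr rfl
      intro j _
      rw [map_mul, hψX]
      congr 1
      exact algHom_C _ _
    have hφψ : φ.comp ψ = AlgHom.id ℂ _ := by
      apply algHom_ext
      intro i
      rw [AlgHom.comp_apply, hψX, linF_apply, map_sum, AlgHom.id_apply]
      rw [← hone i, ← Matrix.nonsing_inv_mul _ hu, ← hcomb]
      apply Finset.sum_congr rfl
      intro j _
      rw [map_mul, hφX]
      congr 1
      exact algHom_C _ _
    intro s j hj z hz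
    have h1 := Ideal.mem_map_of_mem ψ hz
    rw [Ideal.map_span, map_mul, hψy, ← Set.image_comp] at h1
    have h2 : (ψ ∘ fun i => linF (M i)) = X := funext hψy
    rw [h2] at h1
    have h3 := Ideal.mem_map_of_mem φ (sreg_X s j hj _ h1)
    rw [Ideal.map_span, ← Set.image_comp] at h3
    have h4 : (φ ∘ X) = fun i => linF (M i) := funext hφX
    have h5 : φ (ψ z) = z := DFunLike.congr_fun hφψ z
    rw [h4, h5] at h3
    exact h3
  · intro A hA
    rw [hspan]
    have hc : ∀ i j, constantCoeff (A i j) = M i j := by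
      intro i j
      have := congrArg (fun p => constantCoeff (pderiv j p)) (hA i)
      simp only [linF_apply, map_sum, Derivation.leibniz, pderiv_C, map_add, smul_eq_mul,
        map_mul, constantCoeff_X, pderiv_X, zero_mul, add_zero, mul_zero, constantCoeff_C,
        Pi.single_apply, apply_ite constantCoeff, map_zero, mul_ite, mul_one,
        Finset.sum_ite_eq', Finset.mem_univ, if_true] at this
      exact this.symm
    have hcd : constantCoeff A.det = M.det := by
      rw [RingHom.map_det]
      congr 1
      ext i j
      exact hc i j
    constructor
    · rw [mem_vars_iff, hcd]
      exact hdet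
    · intro z _
      refine ⟨C (constantCoeff z / M.det), ?_⟩
      rw [mem_vars_iff, map_sub, map_mul, hcd, constantCoeff_C, div_mul_cancel₀ _ hdet, sub_self]

lemma isHom_one_linF {p : MvPolynomial (Fin m) ℂ} (hp : p.IsHomogeneous 1) :
    ∃ c, p = linF c := by
  have : p ∈ homogeneousSubmodule (Fin m) ℂ 1 := hp
  rw [homogeneousSubmodule_one_eq_span_X, Submodule.mem_span_range_iff_exists_fun] at this
  obtain ⟨c, hc⟩ := this
  exact ⟨c, by rw [← hc]; rfl⟩

theorem main_induction (s : Finset (Fin m)) :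
    ∀ (y : Fin m → MvPolynomial (Fin m) ℂ) (e : Fin m → ℕ),
    (∀ i, (y i).IsHomogeneous (e i)) → (∀ i, 1 ≤ e i) →
    idealOfVars (Fin m) ℂ ≤ (Ideal.span (Set.range y)).radical →
    (∀ i, i ∉ s → e i = 1) →
    SReg y ∧ Wiebe y ∧
      (1 - PowerSeries.X) ^ m * hilbertSeries (Ideal.span (Set.range y)) =
        ∏ i, (1 - PowerSeries.X ^ (e i)) := by
  induction s using Finset.induction_on with
  | empty =>
    intro y e hy he hrad hs
    have he1 : ∀ i, e i = 1 := fun i => hs i (by simp)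
    choose M hM using fun i => isHom_one_linF (p := y i) (by rw [← he1 i]; exact hy i)
    obtain rfl : y = fun i => linF (M i) := funext hM
    obtain ⟨h1, h2, h3⟩ := base_case M hrad
    refine ⟨h1, h2, ?_⟩
    rw [h3, hilbert_vars]
    simp [he1]
  | insert k s hks ih =>
    intro y e hy he hrad hs
    obtain ⟨c, hc⟩ := exists_linear hy he hrad k
    set y2 := Function.update y k (linF c) with hy2
    set e2 := Function.update e k 1 with he2
    have hy2h : ∀ i, (y2 i).IsHomogeneous (e2 i) := by
      intro i
      by_cases hi : i = k
      · subst hi; simpa [hy2, he2] using linF_hom c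
      · simpa [hy2, he2, hi] using hy i
    have he2h : ∀ i, 1 ≤ e2 i := by
      intro i
      by_cases hi : i = k
      · subst hi; simp [he2]
      · simpa [he2, hi] using he i
    obtain ⟨hr, hW, hH⟩ := ih y2 e2 hy2h he2h hc (by
      intro i hi
      by_cases hik : i = k
      · subst hik; simp [he2]
      · simpa [he2, hik] using hs i (by simp [hi, hik]))
    have hyy : y = Function.update y2 k (y k) := by simp [hy2]
    have hy2k : y2 k = linF c := by simp [hy2]
    have hl : linF c ∈ (Ideal.span (Set.range y)).radical :=
      hrad (by simpa using isHom_mem_vars (linF_hom c) le_rfl)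
    obtain ⟨N, hN⟩ := hl
    have hN1 : y2 k ^ (N + 1) ∈ Ideal.span (Set.range (Function.update y2 k (y k))) := by
      rw [← hyy, hy2k, pow_succ]
      exact Ideal.mul_mem_right _ _ hN
    have hr' : SReg y := by
      rw [hyy]
      exact sreg_exchange hy2h he2h hr k (N + 1) hN1
    have hcoe : ((Finset.univ.erase k : Finset (Fin m)) : Set (Fin m)) = {k}ᶜ := by
      ext i; simp
    have him : y2 '' {k}ᶜ = y '' {k}ᶜ := update_image_of_notMem _ _ _ _ (by simp)
    have hnz2 : NzMod (Ideal.span (y2 '' {k}ᶜ)) (y2 k) := by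
      have := hr (Finset.univ.erase k) k (by simp)
      rwa [hcoe] at this
    have hnz : NzMod (Ideal.span (y '' {k}ᶜ)) (y k) := by
      have := hr' (Finset.univ.erase k) k (by simp)
      rwa [hcoe] at this
    refine ⟨hr', ?_, ?_⟩
    · rw [hyy]
      exact wiebe_exchange k hnz2 (fun j => C (c j)) (by rw [hy2k, linF_apply]) N hN1 hW
    · have hI : HomI (Ideal.span (y '' {k}ᶜ)) := by
        apply homI_span
        rintro _ ⟨i, -, rfl⟩
        exact ⟨_, hy i⟩
      have h1 := hilbert_step hI (hy k) hnz (fun z => mem_span_range_iff y k z)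
      have h2 := hilbert_step (him ▸ hI) (hy2h k) hnz2 (fun z => mem_span_range_iff y2 k z)
      rw [him] at h2
      have he2k : e2 k = 1 := by simp [he2]
      rw [he2k, pow_one] at h2
      have h3 : ∏ i, (1 - (PowerSeries.X : PowerSeries ℤ) ^ (e2 i)) =
          (1 - PowerSeries.X) * ∏ i ∈ Finset.univ.erase k, (1 - PowerSeries.X ^ (e i)) := by
        rw [← Finset.mul_prod_erase _ _ (Finset.mem_univ k), he2k, pow_one]
        congr 1
        apply Finset.prod_congr rfl
        intro i hi
        rw [he2, Function.update_of_ne (Finset.ne_of_mem_erase hi)]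
      rw [h2, h3] at hH
      rw [h1, ← Finset.mul_prod_erase _ _ (Finset.mem_univ k)]
      have hX : (1 - PowerSeries.X : PowerSeries ℤ) ≠ 0 := by
        intro h
        have := congrArg PowerSeries.constantCoeff h
        simp at this
      apply mul_left_cancel₀ hX
      linear_combination (1 - PowerSeries.X ^ (e k)) * hH

lemma artinian_of_radical {J : Ideal (MvPolynomial (Fin m) ℂ)}
    (h : idealOfVars (Fin m) ℂ ≤ J.radical) : IsArtinianRing (MvPolynomial (Fin m) ℂ ⧸ J) := by
  rw [isArtinianRing_iff_isNoetherianRing_krullDimLE_zero]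
  refine ⟨inferInstance, ?_⟩
  rw [Ring.krullDimLE_zero_iff]
  intro P hP
  have hmax : (idealOfVars (Fin m) ℂ).IsMaximal := by
    have : idealOfVars (Fin m) ℂ = RingHom.ker (constantCoeff (σ := Fin m) (R := ℂ)) := by
      ext p
      rw [mem_vars_iff, RingHom.mem_ker]
    rw [this]
    apply RingHom.ker_isMaximal_of_surjective
    intro c
    exact ⟨C c, constantCoeff_C _ _⟩
  have hQ : (P.comap (Ideal.Quotient.mk J)).IsPrime := inferInstance
  have hJQ : J ≤ P.comap (Ideal.Quotient.mk J) := by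
    intro z hz
    rw [Ideal.mem_comap, Ideal.Quotient.eq_zero_iff_mem.2 hz]
    exact P.zero_mem
  have h1 := h.trans (hQ.radical_le_iff.2 hJQ)
  have h2 := hmax.eq_of_le hQ.ne_top h1
  rw [h2] at hmax
  have h3 := Ideal.map_eq_top_or_isMaximal_of_surjective (Ideal.Quotient.mk J)
    Ideal.Quotient.mk_surjective hmax
  rw [Ideal.map_comap_of_surjective _ Ideal.Quotient.mk_surjective] at h3
  exact h3.resolve_left hP.ne_top

lemma det_isHom {M : Matrix (Fin m) (Fin m) (MvPolynomial (Fin m) ℂ)} {e : ℕ}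
    (h : ∀ i j, (M i j).IsHomogeneous e) : M.det.IsHomogeneous (m * e) := by
  rw [Matrix.det_apply]
  apply IsHomogeneous.sum
  intro σ _
  have h1 : (∏ i, M (σ i) i).IsHomogeneous (m * e) := by
    have := IsHomogeneous.prod Finset.univ (fun i => M (σ i) i) (fun _ => e) (fun i _ => h _ _)
    simpa using this
  rcases Int.units_eq_one_or (Equiv.Perm.sign σ) with hs | hs
  · rw [hs, one_smul]; exact h1
  · rw [hs, Units.neg_smul, one_smul]; exact h1.neg

end Milnor
set_option maxHeartbeats 1000000 in
lemma socle_core {n d : ℕ} (hd : 2 ≤ d)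
    (f : MvPolynomial (Fin (n + 1)) ℂ) (hf : f.IsHomogeneous d)
    (hsm : ∀ x : Fin (n + 1) → ℂ, (∀ i, eval x (pderiv i f) = 0) → x = 0)
    (J : Ideal (MvPolynomial (Fin (n + 1)) ℂ))
    (hJ : J = Ideal.span (Set.range fun i => pderiv i f))
    (h : MvPolynomial (Fin (n + 1)) ℂ) (hh : h = (hessianMatrix f).det) :
    IsArtinianRing (MvPolynomial (Fin (n + 1)) ℂ ⧸ J) ∧
    (Ideal.span {Ideal.Quotient.mk (J) h} =
      Submodule.annihilator
        ((Ideal.span (Set.range fun i =>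
            Ideal.Quotient.mk (J) (X i))) :
          Submodule (MvPolynomial (Fin (n + 1)) ℂ ⧸ J)
            (MvPolynomial (Fin (n + 1)) ℂ ⧸ J))) ∧
    Module.finrank ℂ (Submodule.restrictScalars ℂ
      (Submodule.annihilator
        ((Ideal.span (Set.range fun i =>
            Ideal.Quotient.mk (J) (X i))) :
          Submodule (MvPolynomial (Fin (n + 1)) ℂ ⧸ J)
            (MvPolynomial (Fin (n + 1)) ℂ ⧸ J)))) = 1 ∧
    hilbertSeries (J ⊔ Ideal.span {h}) =
      (∑ i ∈ Finset.range (d - 1), (PowerSeries.X : PowerSeries ℤ) ^ i) ^ (n + 1) -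
        (PowerSeries.X : PowerSeries ℤ) ^ ((n + 1) * (d - 2)) := by
  have hmemJ : ∀ i, pderiv i f ∈ J := fun i => by
    rw [hJ]; exact Ideal.subset_span ⟨i, rfl⟩
  have hd0 : ((d - 1 : ℕ) : ℂ) ≠ 0 := by
    rw [Nat.cast_ne_zero]; omega
  have hrad : idealOfVars (Fin (n + 1)) ℂ ≤ J.radical := by
    rw [← vanishingIdeal_zeroLocus_eq_radical (K := ℂ) J, idealOfVars, Ideal.span_le]
    rintro _ ⟨j, rfl⟩
    rw [SetLike.mem_coe, mem_vanishingIdeal_iff]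
    intro x hx
    have : x = 0 := by
      apply hsm
      intro i
      have := (mem_zeroLocus_iff.1 hx) (pderiv i f) (hmemJ i)
      simpa using this
    subst this
    simp
  have hyh : ∀ i, (pderiv i f).IsHomogeneous (d - 1) := fun i => hf.pderiv
  obtain ⟨-, hW, hH⟩ := main_induction Finset.univ (fun i => pderiv i f) (fun _ => d - 1)
    hyh (fun _ => by omega) (hJ ▸ hrad) (by simp)
  rw [← hJ] at hH
  have hJhom : HomI J := by
    rw [hJ]
    apply homI_span
    rintro _ ⟨i, rfl⟩
    exact ⟨_, hyh i⟩
  have hhom : h.IsHomogeneous ((n + 1) * (d - 2)) := by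
    rw [hh]
    apply det_isHom
    intro i j
    exact (hyh j).pderiv
  set c : MvPolynomial (Fin (n + 1)) ℂ := C ((d - 1 : ℕ) : ℂ)⁻¹ with hc
  set c' : MvPolynomial (Fin (n + 1)) ℂ := C ((d - 1 : ℕ) : ℂ) with hc'
  have hcc : c' * c = 1 := by
    rw [hc, hc', ← C_mul, mul_inv_cancel₀ hd0, C_1]
  set A : Matrix (Fin (n + 1)) (Fin (n + 1)) (MvPolynomial (Fin (n + 1)) ℂ) := (c • hessianMatrix f).transpose with hA
  have hAdet : A.det = c ^ (n + 1) * h := by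
    rw [hA, Matrix.det_transpose, Matrix.det_smul, Fintype.card_fin, hh]
  have hdetA : c' ^ (n + 1) * A.det = h := by
    rw [hAdet, ← mul_assoc, ← mul_pow, hcc, one_pow, one_mul]
  have hAy : ∀ i, pderiv i f = ∑ j, A i j * X j := by
    intro i
    have h1 := (hyh i).sum_X_mul_pderiv
    have h2 : ∑ j, A i j * X j = c * ∑ j, X j * pderiv j (pderiv i f) := by
      rw [Finset.mul_sum]
      apply Finset.sum_congr rfl
      intro j _
      simp only [hA, Matrix.transpose_apply, Matrix.smul_apply, hessianMatrix, Matrix.of_apply,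
        smul_eq_mul]
      ring
    rw [h2, h1, nsmul_eq_mul, ← mul_assoc]
    have h3 : (((d - 1 : ℕ) : MvPolynomial (Fin (n + 1)) ℂ)) = c' := by rw [hc', map_natCast]
    rw [h3, mul_comm c, hcc, one_mul]
  obtain ⟨hW1, hW2⟩ := hW A hAy
  rw [← hJ] at hW1 hW2
  have hhJ : h ∉ J := by
    intro hmem
    apply hW1
    rw [hAdet]
    exact J.mul_mem_left _ hmem
  have hXh : ∀ j, X j * h ∈ J := by
    intro j
    have := cramer_mem J A X (fun i => by
      rw [← hAy i]
      exact hmemJ i) j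
    rw [← hdetA, mul_left_comm]
    exact J.mul_mem_left _ this
  have hvh : ∀ v ∈ idealOfVars (Fin (n + 1)) ℂ, v * h ∈ J := by
    intro v hv
    have : idealOfVars (Fin (n + 1)) ℂ ≤ J.colon {h} := by
      rw [idealOfVars, Ideal.span_le]
      rintro _ ⟨j, rfl⟩
      rw [SetLike.mem_coe, Submodule.mem_colon_singleton]
      exact hXh j
    exact Submodule.mem_colon_singleton.1 (this hv)
  have hwh : ∀ w : MvPolynomial (Fin (n + 1)) ℂ, w * h - C (constantCoeff w) * h ∈ J := by
    intro w
    rw [← sub_mul]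
    apply hvh
    rw [mem_vars_iff]
    simp
  have hann : ∀ a : MvPolynomial (Fin (n + 1)) ℂ ⧸ J, a ∈ Submodule.annihilator
        ((Ideal.span (Set.range fun i => Ideal.Quotient.mk J (X i))) :
          Submodule (MvPolynomial (Fin (n + 1)) ℂ ⧸ J) (MvPolynomial (Fin (n + 1)) ℂ ⧸ J)) ↔ ∃ t : ℂ, a = Ideal.Quotient.mk J (C t * h) := by
    intro a
    obtain ⟨z, rfl⟩ := Ideal.Quotient.mk_surjective a
    rw [Ideal.span, Submodule.mem_annihilator_span]
    constructor
    · intro hz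
      obtain ⟨w, hw⟩ := hW2 z (by
        intro j
        have := hz ⟨_, ⟨j, rfl⟩⟩
        rw [smul_eq_mul, ← map_mul, Ideal.Quotient.eq_zero_iff_mem] at this
        rwa [mul_comm])
      refine ⟨constantCoeff (w * c ^ (n + 1)), ?_⟩
      rw [Ideal.Quotient.eq]
      have h1 := J.add_mem hw (hwh (w * c ^ (n + 1)))
      rw [hAdet] at h1
      convert h1 using 1
      ring
    · rintro ⟨t, ht⟩
      rw [ht]
      rintro ⟨_, ⟨j, rfl⟩⟩
      rw [smul_eq_mul, ← map_mul, Ideal.Quotient.eq_zero_iff_mem]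
      have := J.mul_mem_left (C t) (hXh j)
      convert this using 1
      ring
  refine ⟨artinian_of_radical hrad, ?_, ?_, ?_⟩
  · ext a
    rw [hann, Ideal.mem_span_singleton']
    constructor
    · rintro ⟨b, rfl⟩
      obtain ⟨w, rfl⟩ := Ideal.Quotient.mk_surjective b
      refine ⟨constantCoeff w, ?_⟩
      rw [← map_mul, Ideal.Quotient.eq]
      exact hwh w
    · rintro ⟨t, rfl⟩
      exact ⟨Ideal.Quotient.mk J (C t), by rw [map_mul]⟩
  · have : Submodule.restrictScalars ℂ (Submodule.annihilator
        ((Ideal.span (Set.range fun i => Ideal.Quotient.mk J (X i))) :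
          Submodule (MvPolynomial (Fin (n + 1)) ℂ ⧸ J) (MvPolynomial (Fin (n + 1)) ℂ ⧸ J))) = Submodule.span ℂ {Ideal.Quotient.mk J h} := by
      ext a
      rw [Submodule.restrictScalars_mem, hann, Submodule.mem_span_singleton]
      constructor
      · rintro ⟨t, rfl⟩
        refine ⟨t, ?_⟩
        rw [← smul_eq_C_mul]
        rfl
      · rintro ⟨t, rfl⟩
        refine ⟨t, ?_⟩
        rw [← smul_eq_C_mul]
        rfl
    rw [this]
    apply finrank_span_singleton
    rwa [Ne, Ideal.Quotient.eq_zero_iff_mem]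
  · rw [hilbert_socle hJhom hhom hhJ]
    · congr 1
      have hX : (1 - PowerSeries.X : PowerSeries ℤ) ≠ 0 := by
        intro h
        have := congrArg PowerSeries.constantCoeff h
        simp at this
      apply mul_left_cancel₀ (pow_ne_zero (n + 1) hX)
      rw [hH, ← mul_pow, mul_neg_geom_sum]
      simp
    · intro z
      rw [sup_comm, Ideal.mem_span_singleton_sup]
      constructor
      · rintro ⟨w, b, hb, rfl⟩
        refine ⟨constantCoeff w, ?_⟩
        have := J.add_mem (hwh w) hb
        convert this using 1
        ring
      · rintro ⟨t, ht⟩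
        exact ⟨C t, _, ht, by ring⟩

/-- If `f` is homogeneous of degree `d ≥ 2` with `V(f)` smooth, then
`M(f) = S/J_f` is an Artinian Gorenstein ring whose one-dimensional socle (in
degree `T = (n+1)(d-2)`) is spanned by the class of the Hessian determinant
`h(f)`; consequently
`HP(H_{n+1}(f);t) = HP(M(f);t) - t^T = ((1-t^{d-1})/(1-t))^{n+1} - t^T`. -/
theorem socle_milnor_algebra_smooth {n d : ℕ} (hd : 2 ≤ d)
    (f : MvPolynomial (Fin (n + 1)) ℂ) (hf : f.IsHomogeneous d)
    (hsm : ∀ x : Fin (n + 1) → ℂ, (∀ i, eval x (pderiv i f) = 0) → x = 0) :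
    IsArtinianRing (MvPolynomial (Fin (n + 1)) ℂ ⧸ jacobianIdeal f) ∧
    (Ideal.span {Ideal.Quotient.mk (jacobianIdeal f) (hessianMatrix f).det} =
      Submodule.annihilator
        ((Ideal.span (Set.range fun i =>
            Ideal.Quotient.mk (jacobianIdeal f) (X i))) :
          Submodule (MvPolynomial (Fin (n + 1)) ℂ ⧸ jacobianIdeal f)
            (MvPolynomial (Fin (n + 1)) ℂ ⧸ jacobianIdeal f))) ∧
    Module.finrank ℂ (Submodule.restrictScalars ℂ
      (Submodule.annihilator
        ((Ideal.span (Set.range fun i =>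
            Ideal.Quotient.mk (jacobianIdeal f) (X i))) :
          Submodule (MvPolynomial (Fin (n + 1)) ℂ ⧸ jacobianIdeal f)
            (MvPolynomial (Fin (n + 1)) ℂ ⧸ jacobianIdeal f)))) = 1 ∧
    hilbertSeries (jacobianIdeal f ⊔ Ideal.span {(hessianMatrix f).det}) =
      (∑ i ∈ Finset.range (d - 1), (PowerSeries.X : PowerSeries ℤ) ^ i) ^ (n + 1) -
        (PowerSeries.X : PowerSeries ℤ) ^ ((n + 1) * (d - 2)) := by
  exact socle_core hd f hf hsm _ rfl _ rfl
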